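/- Let d ≥ 1, L ≥ 2, Φ ∈ ℝ^{d×d}, φ > 0, and W_1,…,W_L ∈ ℝ^{d×d}. Assume: ‖W_l‖₂ ≤ α for l = 1,…,L−1 with 1 ≤ α^{2(L−1)} < L φ²; ‖D_l‖₂ ≤ δ ≤ (2 L³ φ²)^{−1} for l = 1,…,L−2; and ‖I + D_{L−1}‖₂ ≤ ε ≤ (4 L²)^{−1}. Let R⁺ denote the loss at the updated weights W_l⁺ = W_l − η ∇_l R. If 0 < η ≤ min{(64 L² φ³ √R)^{−1}, (144 L² φ⁴)^{−1}}, then R⁺ ≤ (1 − η/2) R. -/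

import Mathlib

open Matrix

namespace ZAS

/-- `seg W l₁ l₂ = W l₂ * W (l₂-1) * ⋯ * W l₁` (the empty product, when `l₂ < l₁`, is `1`). -/
noncomputable def seg {d : ℕ} (W : ℕ → Matrix (Fin d) (Fin d) ℝ) (l₁ : ℕ) :
    ℕ → Matrix (Fin d) (Fin d) ℝ
  | 0 => 1
  | (k+1) => if k + 1 < l₁ then 1 else W (k+1) * seg W l₁ k

/-- Squared Frobenius norm `‖A‖_F²`. -/
noncomputable def frobSq {m n : ℕ} (A : Matrix (Fin m) (Fin n) ℝ) : ℝ :=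
  ∑ i, ∑ j, (A i j)^2

/-- Frobenius norm `‖A‖_F`. -/
noncomputable def frob {m n : ℕ} (A : Matrix (Fin m) (Fin n) ℝ) : ℝ :=
  Real.sqrt (frobSq A)

/-- Frobenius inner product `⟨A, B⟩ = tr(Aᵀ B)`. -/
noncomputable def finner {m n : ℕ} (A B : Matrix (Fin m) (Fin n) ℝ) : ℝ :=
  ∑ i, ∑ j, A i j * B i j

/-- The loss `R(W_1, …, W_L) = (1/2) ‖W_{L:1} - Φ‖_F²`. -/
noncomputable def loss {d : ℕ} (W : ℕ → Matrix (Fin d) (Fin d) ℝ)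
    (Φ : Matrix (Fin d) (Fin d) ℝ) (L : ℕ) : ℝ :=
  frobSq (seg W 1 L - Φ) / 2

/-- The gradient `∇_l R = W_{L:l+1}ᵀ (W_{L:1} - Φ) W_{l-1:1}ᵀ`. -/
noncomputable def grad {d : ℕ} (W : ℕ → Matrix (Fin d) (Fin d) ℝ)
    (Φ : Matrix (Fin d) (Fin d) ℝ) (L l : ℕ) : Matrix (Fin d) (Fin d) ℝ :=
  (seg W (l+1) L)ᵀ * (seg W 1 L - Φ) * (seg W 1 (l-1))ᵀ

/-- The invariant matrices `D_l = W_{l+1}ᵀ W_{l+1} - W_l W_lᵀ`. -/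
noncomputable def Dmat {d : ℕ} (W : ℕ → Matrix (Fin d) (Fin d) ℝ) (l : ℕ) :
    Matrix (Fin d) (Fin d) ℝ :=
  (W (l+1))ᵀ * W (l+1) - W l * (W l)ᵀ

/-- Spectral norm (operator 2-norm) of a square real matrix. -/
noncomputable def spec {d : ℕ} (A : Matrix (Fin d) (Fin d) ℝ) : ℝ :=
  ‖Matrix.toEuclideanCLM (𝕜 := ℝ) A‖

/-- The loss on data: `R̃ = (1/2) ‖W_{L:1} X - Y‖_F²`. -/
noncomputable def lossT {d n : ℕ} (W : ℕ → Matrix (Fin d) (Fin d) ℝ)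
    (X Y : Matrix (Fin d) (Fin n) ℝ) (L : ℕ) : ℝ :=
  frobSq (seg W 1 L * X - Y) / 2

/-- The gradient of the data loss: `∇_l R̃ = W_{L:l+1}ᵀ (W_{L:1} X - Y) Xᵀ W_{l-1:1}ᵀ`. -/
noncomputable def gradT {d n : ℕ} (W : ℕ → Matrix (Fin d) (Fin d) ℝ)
    (X Y : Matrix (Fin d) (Fin n) ℝ) (L l : ℕ) : Matrix (Fin d) (Fin d) ℝ :=
  (seg W (l+1) L)ᵀ * (seg W 1 L * X - Y) * Xᵀ * (seg W 1 (l-1))ᵀ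

end ZAS

open ZAS

namespace ZAS

section Norms

variable {d m n : ℕ}

lemma frobSq_nonneg (A : Matrix (Fin m) (Fin n) ℝ) : 0 ≤ frobSq A :=
  Finset.sum_nonneg fun _ _ => Finset.sum_nonneg fun _ _ => sq_nonneg _

lemma frob_nonneg (A : Matrix (Fin m) (Fin n) ℝ) : 0 ≤ frob A := Real.sqrt_nonneg _

lemma frob_sq (A : Matrix (Fin m) (Fin n) ℝ) : frob A ^ 2 = frobSq A :=
  Real.sq_sqrt (frobSq_nonneg A)

open scoped Matrix.Norms.Frobenius in
lemma frob_eq_norm (A : Matrix (Fin m) (Fin n) ℝ) : frob A = ‖A‖ := by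
  simp [frob, frobSq, Matrix.frobenius_norm_def, Real.sqrt_eq_rpow]

lemma frob_add_le (A B : Matrix (Fin m) (Fin n) ℝ) : frob (A + B) ≤ frob A + frob B := by
  simpa only [frob_eq_norm] using
    @norm_add_le _ Matrix.frobeniusSeminormedAddCommGroup.toSeminormedAddGroup A B

open scoped Matrix.Norms.Frobenius in
lemma frob_sum_le {ι : Type*} (s : Finset ι) (f : ι → Matrix (Fin m) (Fin n) ℝ) :
    frob (∑ i ∈ s, f i) ≤ ∑ i ∈ s, frob (f i) := by
  simpa only [frob_eq_norm] using norm_sum_le s f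

open scoped Matrix.Norms.Frobenius in
lemma frob_smul (c : ℝ) (A : Matrix (Fin m) (Fin n) ℝ) : frob (c • A) = |c| * frob A := by
  simpa only [frob_eq_norm, Real.norm_eq_abs] using norm_smul c A

open scoped Matrix.Norms.Frobenius in
lemma frob_mul_le (A B : Matrix (Fin d) (Fin d) ℝ) : frob (A * B) ≤ frob A * frob B := by
  simpa only [frob_eq_norm] using Matrix.frobenius_norm_mul A B

lemma frobSq_transpose (A : Matrix (Fin m) (Fin n) ℝ) : frobSq Aᵀ = frobSq A :=
  Finset.sum_comm

lemma frob_transpose (A : Matrix (Fin m) (Fin n) ℝ) : frob Aᵀ = frob A := by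
  simp [frob, frobSq_transpose]

lemma frobSq_mul_eq_sum_norm_sq (A B : Matrix (Fin d) (Fin d) ℝ) :
    frobSq (A * B) =
      ∑ j, ‖Matrix.toEuclideanCLM (𝕜 := ℝ) A (WithLp.toLp 2 fun i => B i j)‖ ^ 2 := by
  rw [frobSq, Finset.sum_comm]
  simp [EuclideanSpace.norm_sq_eq, Matrix.mul_apply, Matrix.mulVec, dotProduct]

lemma frobSq_eq_sum_norm_sq (B : Matrix (Fin d) (Fin d) ℝ) :
    frobSq B = ∑ j, ‖(WithLp.toLp 2 fun i => B i j : EuclideanSpace ℝ (Fin d))‖ ^ 2 := by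
  simpa using frobSq_mul_eq_sum_norm_sq 1 B

lemma spec_nonneg (A : Matrix (Fin d) (Fin d) ℝ) : 0 ≤ spec A := norm_nonneg _

lemma norm_toEuclideanCLM_le (A : Matrix (Fin d) (Fin d) ℝ) (x : EuclideanSpace ℝ (Fin d)) :
    ‖Matrix.toEuclideanCLM (𝕜 := ℝ) A x‖ ≤ spec A * ‖x‖ :=
  ContinuousLinearMap.le_opNorm _ _

lemma spec_one_le : spec (1 : Matrix (Fin d) (Fin d) ℝ) ≤ 1 := by
  rw [spec, map_one]
  exact ContinuousLinearMap.norm_id_le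

lemma spec_mul_le (A B : Matrix (Fin d) (Fin d) ℝ) : spec (A * B) ≤ spec A * spec B := by
  rw [spec, map_mul]
  exact norm_mul_le _ _

lemma toEuclideanCLM_transpose (A : Matrix (Fin d) (Fin d) ℝ) :
    Matrix.toEuclideanCLM (𝕜 := ℝ) Aᵀ =
      ContinuousLinearMap.adjoint (Matrix.toEuclideanCLM (𝕜 := ℝ) A) := by
  rw [← ContinuousLinearMap.star_eq_adjoint, ← map_star, Matrix.star_eq_conjTranspose,
    Matrix.conjTranspose_eq_transpose_of_trivial]

lemma spec_transpose (A : Matrix (Fin d) (Fin d) ℝ) : spec Aᵀ = spec A := by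
  rw [spec, toEuclideanCLM_transpose, LinearIsometryEquiv.norm_map, spec]

lemma frob_mul_le_spec_mul (A B : Matrix (Fin d) (Fin d) ℝ) :
    frob (A * B) ≤ spec A * frob B := by
  refine abs_le_of_sq_le_sq' ?_ (mul_nonneg (spec_nonneg A) (frob_nonneg B)) |>.2
  rw [mul_pow, frob_sq, frob_sq, frobSq_mul_eq_sum_norm_sq, frobSq_eq_sum_norm_sq,
    Finset.mul_sum]
  refine Finset.sum_le_sum fun j _ => ?_
  rw [← mul_pow]
  exact pow_le_pow_left₀ (norm_nonneg _) (norm_toEuclideanCLM_le _ _) 2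

lemma frob_mul_le_mul_spec (A B : Matrix (Fin d) (Fin d) ℝ) :
    frob (A * B) ≤ frob A * spec B := by
  rw [← frob_transpose, Matrix.transpose_mul, ← frob_transpose A, ← spec_transpose B, mul_comm]
  exact frob_mul_le_spec_mul _ _

lemma finner_eq_trace (A B : Matrix (Fin m) (Fin n) ℝ) :
    finner A B = (Aᵀ * B).trace := by
  rw [finner, Finset.sum_comm]
  simp [Matrix.trace, Matrix.mul_apply]

lemma finner_self (A : Matrix (Fin m) (Fin n) ℝ) : finner A A = frobSq A := by
  simp [finner, frobSq, sq]

lemma finner_mul_mul (E A G B : Matrix (Fin d) (Fin d) ℝ) :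
    finner E (A * G * B) = finner (Aᵀ * E * Bᵀ) G := by
  simp only [finner_eq_trace, Matrix.transpose_mul, Matrix.transpose_transpose]
  rw [← Matrix.mul_assoc, Matrix.trace_mul_comm]
  simp only [Matrix.mul_assoc]

lemma finner_add_right (A B C : Matrix (Fin m) (Fin n) ℝ) :
    finner A (B + C) = finner A B + finner A C := by
  simp [finner_eq_trace, Matrix.mul_add]

lemma finner_smul_right (c : ℝ) (A B : Matrix (Fin m) (Fin n) ℝ) :
    finner A (c • B) = c * finner A B := by
  simp [finner_eq_trace]

lemma finner_sum_right {ι : Type*} (s : Finset ι) (A : Matrix (Fin m) (Fin n) ℝ)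
    (f : ι → Matrix (Fin m) (Fin n) ℝ) :
    finner A (∑ i ∈ s, f i) = ∑ i ∈ s, finner A (f i) := by
  simp [finner_eq_trace, Matrix.mul_sum, Matrix.trace_sum]

lemma frobSq_add (A B : Matrix (Fin m) (Fin n) ℝ) :
    frobSq (A + B) = frobSq A + 2 * finner A B + frobSq B := by
  simp only [frobSq, finner, Finset.mul_sum, ← Finset.sum_add_distrib, Matrix.add_apply]
  exact Finset.sum_congr rfl fun _ _ => Finset.sum_congr rfl fun _ _ => by ring

lemma abs_finner_le (A B : Matrix (Fin m) (Fin n) ℝ) : |finner A B| ≤ frob A * frob B := by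
  refine abs_le_of_sq_le_sq ?_ (mul_nonneg (frob_nonneg A) (frob_nonneg B))
  rw [mul_pow, frob_sq, frob_sq]
  simp only [finner, frobSq, ← Finset.sum_product']
  exact Finset.sum_mul_sq_le_sq_mul_sq _ _ _

end Norms

section LowerBounds

variable {d : ℕ}

lemma norm_sq_toEuclideanCLM (A : Matrix (Fin d) (Fin d) ℝ) (x : EuclideanSpace ℝ (Fin d)) :
    ‖Matrix.toEuclideanCLM (𝕜 := ℝ) A x‖ ^ 2 =
      inner ℝ x (Matrix.toEuclideanCLM (𝕜 := ℝ) (Aᵀ * A) x) := by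
  rw [map_mul, toEuclideanCLM_transpose, mul_apply_eq_comp,
    ContinuousLinearMap.adjoint_inner_right, real_inner_self_eq_norm_sq]

lemma abs_inner_toEuclideanCLM_le (A : Matrix (Fin d) (Fin d) ℝ)
    (x : EuclideanSpace ℝ (Fin d)) :
    |inner ℝ x (Matrix.toEuclideanCLM (𝕜 := ℝ) A x)| ≤ spec A * ‖x‖ ^ 2 := by
  refine (abs_real_inner_le_norm _ _).trans ?_
  nlinarith [norm_toEuclideanCLM_le A x, norm_nonneg x]

/-- `c ≤ σ_min(A)²`, phrased through quadratic forms. -/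
def SqBoundedBelow (A : Matrix (Fin d) (Fin d) ℝ) (c : ℝ) : Prop :=
  ∀ x : EuclideanSpace ℝ (Fin d), c * ‖x‖ ^ 2 ≤ ‖Matrix.toEuclideanCLM (𝕜 := ℝ) A x‖ ^ 2

lemma SqBoundedBelow.of_transpose {A : Matrix (Fin d) (Fin d) ℝ} {c : ℝ} (hc : 0 < c)
    (h : SqBoundedBelow Aᵀ c) : SqBoundedBelow A c := by
  intro x
  have hinj : Function.Injective (Matrix.toEuclideanCLM (𝕜 := ℝ) Aᵀ).toLinearMap := by
    rw [← LinearMap.ker_eq_bot, LinearMap.ker_eq_bot']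
    intro z hz
    have h1 := h z
    rw [show Matrix.toEuclideanCLM (𝕜 := ℝ) Aᵀ z = 0 from hz, norm_zero] at h1
    have h2 : ‖z‖ ^ 2 ≤ 0 := by nlinarith
    simpa using le_antisymm h2 (sq_nonneg _)
  obtain ⟨z, hz⟩ := LinearMap.injective_iff_surjective.mp hinj x
  replace hz : Matrix.toEuclideanCLM (𝕜 := ℝ) Aᵀ z = x := hz
  have hin : ‖x‖ ^ 2 = inner ℝ (Matrix.toEuclideanCLM (𝕜 := ℝ) A x) z := by
    rw [← ContinuousLinearMap.adjoint_inner_right, ← toEuclideanCLM_transpose, hz,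
      real_inner_self_eq_norm_sq]
  have hcs := real_inner_le_norm (Matrix.toEuclideanCLM (𝕜 := ℝ) A x) z
  rw [← hin] at hcs
  have hzx := h z
  rw [hz] at hzx
  rcases (norm_nonneg x).eq_or_lt with h0 | h0
  · simp [← h0]
  · have hsq : (‖x‖ ^ 2) ^ 2 ≤ ‖Matrix.toEuclideanCLM (𝕜 := ℝ) A x‖ ^ 2 * ‖z‖ ^ 2 := by
      rw [← mul_pow]
      exact pow_le_pow_left₀ (sq_nonneg _) hcs 2
    refine le_of_mul_le_mul_right ?_ (pow_pos h0 2)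
    nlinarith [sq_nonneg ‖Matrix.toEuclideanCLM (𝕜 := ℝ) A x‖]

lemma SqBoundedBelow.mono {A : Matrix (Fin d) (Fin d) ℝ} {b c : ℝ} (h : SqBoundedBelow A c)
    (hbc : b ≤ c) : SqBoundedBelow A b := fun x =>
  (mul_le_mul_of_nonneg_right hbc (sq_nonneg _)).trans (h x)

lemma SqBoundedBelow.mul {A B : Matrix (Fin d) (Fin d) ℝ} {a b : ℝ} (ha : 0 ≤ a)
    (hA : SqBoundedBelow A a) (hB : SqBoundedBelow B b) : SqBoundedBelow (A * B) (a * b) := by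
  intro x
  rw [map_mul, mul_apply_eq_comp, mul_assoc]
  exact (mul_le_mul_of_nonneg_left (hB x) ha).trans (hA _)

lemma SqBoundedBelow.le_frobSq_mul_transpose {B : Matrix (Fin d) (Fin d) ℝ} {c : ℝ}
    (h : SqBoundedBelow B c) (E : Matrix (Fin d) (Fin d) ℝ) :
    c * frobSq E ≤ frobSq (E * Bᵀ) := by
  rw [← frobSq_transpose (E * Bᵀ), Matrix.transpose_mul, Matrix.transpose_transpose,
    ← frobSq_transpose E, frobSq_mul_eq_sum_norm_sq, frobSq_eq_sum_norm_sq, Finset.mul_sum]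
  exact Finset.sum_le_sum fun j _ => h _

lemma norm_sq_eq_add_inner_Dmat (W : ℕ → Matrix (Fin d) (Fin d) ℝ) (l : ℕ)
    (x : EuclideanSpace ℝ (Fin d)) :
    ‖Matrix.toEuclideanCLM (𝕜 := ℝ) (W (l + 1)) x‖ ^ 2 =
      ‖Matrix.toEuclideanCLM (𝕜 := ℝ) (W l)ᵀ x‖ ^ 2 +
        inner ℝ x (Matrix.toEuclideanCLM (𝕜 := ℝ) (Dmat W l) x) := by
  rw [norm_sq_toEuclideanCLM, norm_sq_toEuclideanCLM, Dmat, map_sub,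
    Matrix.transpose_transpose, _root_.sub_apply, inner_sub_right]
  ring

lemma norm_sq_add_norm_sq_eq (W : ℕ → Matrix (Fin d) (Fin d) ℝ) (l : ℕ)
    (x : EuclideanSpace ℝ (Fin d)) :
    ‖Matrix.toEuclideanCLM (𝕜 := ℝ) (W (l + 1)) x‖ ^ 2 + ‖x‖ ^ 2 =
      ‖Matrix.toEuclideanCLM (𝕜 := ℝ) (W l)ᵀ x‖ ^ 2 +
        inner ℝ x (Matrix.toEuclideanCLM (𝕜 := ℝ) (1 + Dmat W l) x) := by
  rw [norm_sq_eq_add_inner_Dmat, map_add, map_one, _root_.add_apply,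
    one_apply_eq_self, inner_add_right, real_inner_self_eq_norm_sq]
  ring

lemma sqBoundedBelow_of_spec_Dmat_le {W : ℕ → Matrix (Fin d) (Fin d) ℝ} {l : ℕ} {c δ : ℝ}
    (hD : spec (Dmat W l) ≤ δ) (hc : 0 < c - δ) (h : SqBoundedBelow (W (l + 1)) c) :
    SqBoundedBelow (W l) (c - δ) := by
  refine SqBoundedBelow.of_transpose hc fun x => ?_
  have h1 := h x
  rw [norm_sq_eq_add_inner_Dmat] at h1
  have h2 := (le_abs_self _).trans (abs_inner_toEuclideanCLM_le (Dmat W l) x)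
  have h3 := mul_le_mul_of_nonneg_right hD (sq_nonneg ‖x‖)
  linarith

lemma sqBoundedBelow_of_spec_one_add_Dmat_le {W : ℕ → Matrix (Fin d) (Fin d) ℝ} {l : ℕ}
    {ε : ℝ} (hD : spec (1 + Dmat W l) ≤ ε) (hε : 0 < 1 - ε) :
    SqBoundedBelow (W l) (1 - ε) := by
  refine SqBoundedBelow.of_transpose hε fun x => ?_
  have h1 := norm_sq_add_norm_sq_eq W l x
  have h2 := (le_abs_self _).trans (abs_inner_toEuclideanCLM_le (1 + Dmat W l) x)
  have h3 := mul_le_mul_of_nonneg_right hD (sq_nonneg ‖x‖)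
  nlinarith [sq_nonneg ‖Matrix.toEuclideanCLM (𝕜 := ℝ) (W (l + 1)) x‖]

lemma spec_sq_le_of_spec_one_add_Dmat_le {W : ℕ → Matrix (Fin d) (Fin d) ℝ} {l : ℕ}
    {α ε : ℝ} (hα : 1 ≤ α) (hW : spec (W l) ≤ α) (hD : spec (1 + Dmat W l) ≤ ε) :
    spec (W (l + 1)) ^ 2 ≤ α ^ 2 - 1 + ε := by
  have hε : 0 ≤ ε := (spec_nonneg _).trans hD
  have hK : 0 ≤ α ^ 2 - 1 + ε := by nlinarith
  rw [← Real.sq_sqrt hK]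
  refine pow_le_pow_left₀ (spec_nonneg _) ?_ 2
  refine ContinuousLinearMap.opNorm_le_bound _ (Real.sqrt_nonneg _) fun x => ?_
  refine abs_le_of_sq_le_sq' ?_ (by positivity) |>.2
  rw [mul_pow, Real.sq_sqrt hK]
  have h1 := norm_sq_add_norm_sq_eq W l x
  have h2 := (le_abs_self _).trans (abs_inner_toEuclideanCLM_le (1 + Dmat W l) x)
  have h3 := mul_le_mul_of_nonneg_right hD (sq_nonneg ‖x‖)
  have h4 : ‖Matrix.toEuclideanCLM (𝕜 := ℝ) (W l)ᵀ x‖ ≤ α * ‖x‖ := by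
    refine (norm_toEuclideanCLM_le _ _).trans ?_
    rw [spec_transpose]
    exact mul_le_mul_of_nonneg_right hW (norm_nonneg _)
  have h5 := pow_le_pow_left₀ (norm_nonneg _) h4 2
  nlinarith

end LowerBounds

section Products

variable {d : ℕ}

lemma seg_succ_of_le (W : ℕ → Matrix (Fin d) (Fin d) ℝ) {l k : ℕ} (h : l ≤ k + 1) :
    seg W l (k + 1) = W (k + 1) * seg W l k := by
  rw [seg, if_neg (by omega)]

lemma seg_of_lt (W : ℕ → Matrix (Fin d) (Fin d) ℝ) {l k : ℕ} (h : k < l) :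
    seg W l k = 1 := by
  cases k with
  | zero => rfl
  | succ k => rw [seg, if_pos h]

lemma spec_seg_le {W : ℕ → Matrix (Fin d) (Fin d) ℝ} {α : ℝ} {n : ℕ}
    (hα : 0 ≤ α) (hW : ∀ l, 1 ≤ l → l ≤ n → spec (W l) ≤ α) (j : ℕ) :
    ∀ k, j + k ≤ n → spec (seg W (j + 1) (j + k)) ≤ α ^ k
  | 0, _ => by
    rw [seg_of_lt W (by omega), pow_zero]
    exact spec_one_le
  | k + 1, hk => by
    rw [← add_assoc, seg_succ_of_le W (by omega), pow_succ']
    exact (spec_mul_le _ _).trans (mul_le_mul (hW _ (by omega) (by omega))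
      (spec_seg_le hα hW j k (by omega)) (spec_nonneg _) hα)

lemma sqBoundedBelow_seg {W : ℕ → Matrix (Fin d) (Fin d) ℝ} {c : ℝ} {n : ℕ}
    (hc : 0 ≤ c) (hW : ∀ l, 1 ≤ l → l ≤ n → SqBoundedBelow (W l) c) :
    ∀ k, k ≤ n → SqBoundedBelow (seg W 1 k) (c ^ k)
  | 0, _ => fun x => by simp [seg]
  | k + 1, hk => by
    rw [seg_succ_of_le W (by omega), pow_succ']
    exact (hW _ (by omega) hk).mul hc (sqBoundedBelow_seg hc hW k (by omega))

/-- Telescoping expansion of a perturbed matrix product. -/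
lemma seg_sub_smul (W G : ℕ → Matrix (Fin d) (Fin d) ℝ) (η : ℝ) (k : ℕ) :
    seg (fun i => W i - η • G i) 1 k - seg W 1 k =
      -(η • ∑ i ∈ Finset.range k,
        seg W (i + 2) k * G (i + 1) * seg (fun i => W i - η • G i) 1 i) := by
  induction k with
  | zero => simp [seg]
  | succ k ih =>
    have hs : ∑ i ∈ Finset.range k,
        seg W (i + 2) (k + 1) * G (i + 1) * seg (fun i => W i - η • G i) 1 i =
        W (k + 1) * ∑ i ∈ Finset.range k,
          seg W (i + 2) k * G (i + 1) * seg (fun i => W i - η • G i) 1 i := by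
      rw [Finset.mul_sum]
      refine Finset.sum_congr rfl fun i hi => ?_
      rw [seg_succ_of_le W (by have := Finset.mem_range.mp hi; omega)]
      simp only [Matrix.mul_assoc]
    rw [Finset.sum_range_succ, hs, seg_of_lt W (show k + 1 < k + 2 by omega),
      seg_succ_of_le _ (by omega), seg_succ_of_le W (by omega), Matrix.one_mul, smul_add,
      ← Matrix.mul_smul, neg_add, ← Matrix.mul_neg, ← ih, Matrix.sub_mul, Matrix.mul_sub,
      Matrix.smul_mul]
    abel

/-- Growth of the perturbation of a matrix product under a small perturbation of its factors. -/
lemma frob_seg_sub_le {W G : ℕ → Matrix (Fin d) (Fin d) ℝ} {α η : ℝ} {n : ℕ} (hα : 1 ≤ α)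
    (hη : 0 ≤ η) (hW : ∀ l, 1 ≤ l → l ≤ n → spec (W l) ≤ α)
    (hS : 2 * η * ∑ i ∈ Finset.range n, frob (G (i + 1)) ≤ 1) (k : ℕ) (hk : k ≤ n) :
    α * frob (seg (fun i => W i - η • G i) 1 k - seg W 1 k) ≤
      2 * η * α ^ k * ∑ i ∈ Finset.range k, frob (G (i + 1)) := by
  have hα0 : 0 ≤ α := zero_le_one.trans hα
  induction k with
  | zero => simp [seg, frob, frobSq]
  | succ k ih =>
    specialize ih (by omega)
    set V : ℕ → Matrix (Fin d) (Fin d) ℝ := fun i => W i - η • G i with hV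
    set u := frob (seg V 1 k - seg W 1 k) with hu
    set S := ∑ i ∈ Finset.range k, frob (G (i + 1)) with hSk
    set g := frob (G (k + 1)) with hg
    have hg0 : 0 ≤ g := frob_nonneg _
    have hSle : 2 * η * S ≤ 1 := by
      refine le_trans (mul_le_mul_of_nonneg_left ?_ (by positivity)) hS
      exact Finset.sum_le_sum_of_subset_of_nonneg
        (Finset.range_mono (by omega)) fun _ _ _ => frob_nonneg _
    have hid : seg V 1 (k + 1) - seg W 1 (k + 1) =
        W (k + 1) * (seg V 1 k - seg W 1 k) +
          (-η) • (G (k + 1) * seg W 1 k + G (k + 1) * (seg V 1 k - seg W 1 k)) := by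
      rw [seg_succ_of_le V (by omega), seg_succ_of_le W (by omega), ← Matrix.mul_add, hV]
      simp only [Matrix.sub_mul, Matrix.mul_sub, Matrix.smul_mul, add_sub_cancel, neg_smul]
      abel
    have hP : spec (seg W 1 k) ≤ α ^ k := by
      simpa using spec_seg_le hα0 hW 0 k (by omega)
    have hstep : frob (seg V 1 (k + 1) - seg W 1 (k + 1)) ≤ α * u + η * (g * α ^ k + g * u) := by
      rw [hid]
      refine (frob_add_le _ _).trans (add_le_add ?_ ?_)
      · exact (frob_mul_le_spec_mul _ _).trans
          (mul_le_mul_of_nonneg_right (hW _ (by omega) hk) (frob_nonneg _))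
      · rw [frob_smul, abs_neg, abs_of_nonneg hη]
        refine mul_le_mul_of_nonneg_left ((frob_add_le _ _).trans (add_le_add ?_ ?_)) hη
        · exact (frob_mul_le_mul_spec _ _).trans (mul_le_mul_of_nonneg_left hP hg0)
        · exact frob_mul_le _ _
    have hpow : α ^ k ≤ α ^ (k + 1) := pow_le_pow_right₀ hα (by omega)
    have hu1 : α * u ≤ α ^ (k + 1) := by
      refine ih.trans (le_trans ?_ hpow)
      have := mul_le_mul_of_nonneg_left hSle (pow_nonneg hα0 k)
      linarith
    rw [Finset.sum_range_succ, ← hSk, ← hg]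
    calc α * frob (seg V 1 (k + 1) - seg W 1 (k + 1))
        ≤ α * (α * u + η * (g * α ^ k + g * u)) := mul_le_mul_of_nonneg_left hstep hα0
      _ = α * (α * u) + η * g * (α ^ (k + 1) + α * u) := by ring
      _ ≤ α * (2 * η * α ^ k * S) + η * g * (α ^ (k + 1) + α ^ (k + 1)) := by gcongr
      _ = 2 * η * α ^ (k + 1) * (S + g) := by ring

end Products

section Descent

variable {d : ℕ}

lemma sqBoundedBelow_of_balanced {W : ℕ → Matrix (Fin d) (Fin d) ℝ} {δ ε : ℝ} {n : ℕ}
    (hδ : 0 ≤ δ) (hpos : 0 < 1 - ε - n * δ)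
    (hD : ∀ l, 1 ≤ l → l ≤ n - 1 → spec (Dmat W l) ≤ δ) (hDn : spec (1 + Dmat W n) ≤ ε)
    (l : ℕ) (hl : 1 ≤ l) (hln : l ≤ n) : SqBoundedBelow (W l) (1 - ε - n * δ) := by
  have key : ∀ k, k < n → SqBoundedBelow (W (n - k)) (1 - ε - k * δ) := by
    intro k
    induction k with
    | zero =>
      intro _
      have : 0 ≤ n * δ := by positivity
      simpa using sqBoundedBelow_of_spec_one_add_Dmat_le hDn (by linarith)
    | succ k ih =>
      intro hk
      have hkn : ((k + 1 : ℕ) : ℝ) * δ ≤ n * δ :=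
        mul_le_mul_of_nonneg_right (by exact_mod_cast hk.le) hδ
      have hk' : 1 - ε - ((k + 1 : ℕ) : ℝ) * δ = 1 - ε - k * δ - δ := by push_cast; ring
      rw [hk']
      refine sqBoundedBelow_of_spec_Dmat_le (hD _ (by omega) (by omega)) (by linarith [hk']) ?_
      rw [show n - (k + 1) + 1 = n - k by omega]
      exact ih (by omega)
  have h := key (n - l) (by omega)
  rw [show n - (n - l) = l by omega] at h
  refine h.mono ?_
  have : ((n - l : ℕ) : ℝ) * δ ≤ n * δ :=
    mul_le_mul_of_nonneg_right (by exact_mod_cast Nat.sub_le n l) hδ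
  linarith

/-- Sufficient decrease of the loss in terms of the squared norm of its gradient. -/
lemma frobSq_step_le {W : ℕ → Matrix (Fin d) (Fin d) ℝ} {Φ : Matrix (Fin d) (Fin d) ℝ}
    {α η r s : ℝ} {n : ℕ} (hα : 1 ≤ α) (hη : 0 ≤ η)
    (hW : ∀ l, 1 ≤ l → l ≤ n → spec (W l) ≤ α) (hs : 0 ≤ s) (hs2 : (n : ℝ) ≤ s ^ 2)
    (hαr : α ^ n ≤ r) (hw : n * spec (W (n + 1)) ^ 2 ≤ r ^ 2)
    (hη1 : η * frob (seg W 1 (n + 1) - Φ) * (s * r ^ 3) ≤ 1 / 40)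
    (hη2 : η * r ^ 4 ≤ 1 / 144) :
    frobSq (seg (fun k => W k - η • grad W Φ (n + 1) k) 1 (n + 1) - Φ) ≤
      frobSq (seg W 1 (n + 1) - Φ) -
        8 / 5 * η * ∑ i ∈ Finset.range (n + 1), frobSq (grad W Φ (n + 1) (i + 1)) := by
  have hα0 : 0 ≤ α := zero_le_one.trans hα
  have hr : 1 ≤ r := (one_le_pow₀ hα).trans hαr
  set E := seg W 1 (n + 1) - Φ with hE
  set e := frob E with he
  set w := spec (W (n + 1)) with hwdef
  set G : ℕ → Matrix (Fin d) (Fin d) ℝ := grad W Φ (n + 1) with hG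
  set V : ℕ → Matrix (Fin d) (Fin d) ℝ := fun k => W k - η • G k with hV
  set g : ℕ → ℝ := fun i => frob (G (i + 1)) with hg
  obtain ⟨S, hS⟩ : ∃ S, S = ∑ i ∈ Finset.range n, g i := ⟨_, rfl⟩
  obtain ⟨N, hN⟩ : ∃ N, N = √(∑ i ∈ Finset.range (n + 1), frobSq (G (i + 1))) := ⟨_, rfl⟩
  have he0 : 0 ≤ e := frob_nonneg _
  have hw0 : 0 ≤ w := spec_nonneg _
  have hg0 : ∀ i, 0 ≤ g i := fun i => frob_nonneg _
  have hS0 : 0 ≤ S := hS ▸ Finset.sum_nonneg fun i _ => hg0 i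
  have hN0 : 0 ≤ N := hN ▸ Real.sqrt_nonneg _
  have hN2 : ∑ i ∈ Finset.range (n + 1), frobSq (G (i + 1)) = N ^ 2 :=
    hN ▸ (Real.sq_sqrt (Finset.sum_nonneg fun i _ => frobSq_nonneg _)).symm
  have hN2' : ∑ i ∈ Finset.range n, g i ^ 2 + g n ^ 2 = N ^ 2 := by
    rw [← hN2, Finset.sum_range_succ]
    simp only [hg, frob_sq]
  have hn0 : (0 : ℝ) ≤ n := n.cast_nonneg
  have hgN : g n ≤ N := abs_le_of_sq_le_sq' (by
    have : 0 ≤ ∑ i ∈ Finset.range n, g i ^ 2 := Finset.sum_nonneg fun _ _ => sq_nonneg _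
    linarith) hN0 |>.2
  have hgn0 := hg0 n
  have hSN2 : S ^ 2 ≤ n * N ^ 2 := by
    have h1 := sq_sum_le_card_mul_sum_sq (s := Finset.range n) (f := g)
    rw [Finset.card_range, ← hS] at h1
    exact h1.trans (mul_le_mul_of_nonneg_left (by linarith [sq_nonneg (g n)]) hn0)
  have hSN : S ≤ s * N := abs_le_of_sq_le_sq' (by
    rw [mul_pow]
    exact hSN2.trans (mul_le_mul_of_nonneg_right hs2 (sq_nonneg _))) (by positivity) |>.2
  have hwS : w * S ≤ r * N := abs_le_of_sq_le_sq' (by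
    calc (w * S) ^ 2 = w ^ 2 * S ^ 2 := by ring
      _ ≤ w ^ 2 * (n * N ^ 2) := by gcongr
      _ = n * w ^ 2 * N ^ 2 := by ring
      _ ≤ r ^ 2 * N ^ 2 := by gcongr
      _ = (r * N) ^ 2 := by ring) (by positivity) |>.2
  have hnw : n * w ≤ s * r := abs_le_of_sq_le_sq' (by
    calc (n * w) ^ 2 = n * (n * w ^ 2) := by ring
      _ ≤ s ^ 2 * r ^ 2 := by gcongr
      _ = (s * r) ^ 2 := by ring) (by positivity) |>.2
  have hB : ∀ i, i ≤ n → spec (seg W 1 i) ≤ α ^ i := fun i hi => by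
    simpa using spec_seg_le hα0 hW 0 i (by omega)
  have hA : ∀ i, i < n → spec (seg W (i + 2) (n + 1)) * α ^ i ≤ w * α ^ n := by
    intro i hi
    have h1 := spec_seg_le hα0 hW (i + 1) (n - (i + 1)) (by omega)
    rw [show i + 1 + (n - (i + 1)) = n by omega] at h1
    calc spec (seg W (i + 2) (n + 1)) * α ^ i
        ≤ w * α ^ (n - (i + 1)) * α ^ i := by
          rw [seg_succ_of_le W (by omega)]
          exact mul_le_mul_of_nonneg_right ((spec_mul_le _ _).trans
            (mul_le_mul_of_nonneg_left h1 hw0)) (by positivity)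
      _ = w * α ^ (n - (i + 1) + i) := by rw [mul_assoc, ← pow_add]
      _ ≤ w * α ^ n := mul_le_mul_of_nonneg_left (pow_le_pow_right₀ hα (by omega)) hw0
  have hgi : ∀ i ∈ Finset.range n, g i ≤ w * r * e := by
    intro i hi
    have hi' := Finset.mem_range.mp hi
    calc g i = frob ((seg W (i + 2) (n + 1))ᵀ * E * (seg W 1 i)ᵀ) := rfl
      _ ≤ frob ((seg W (i + 2) (n + 1))ᵀ * E) * spec (seg W 1 i)ᵀ := frob_mul_le_mul_spec _ _
      _ ≤ spec (seg W (i + 2) (n + 1)) * e * α ^ i := by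
        refine mul_le_mul ?_ ?_ (spec_nonneg _) (mul_nonneg (spec_nonneg _) he0)
        · rw [← spec_transpose (seg W (i + 2) (n + 1))]
          exact frob_mul_le_spec_mul _ _
        · rw [spec_transpose]
          exact hB i hi'.le
      _ = spec (seg W (i + 2) (n + 1)) * α ^ i * e := by ring
      _ ≤ w * α ^ n * e := mul_le_mul_of_nonneg_right (hA i hi') he0
      _ ≤ w * r * e := by gcongr
  obtain ⟨q, hq⟩ : ∃ q, q = 2 * η * S := ⟨_, rfl⟩
  have hq0 : 0 ≤ q := by rw [hq]; positivity
  have hηesr : η * e * (s * r ^ 2) ≤ 1 / 40 := by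
    refine le_trans ?_ hη1
    gcongr
    norm_num
  have hq1 : q ≤ 1 / 20 := by
    have h1 : S ≤ s * r * r * e := by
      calc S ≤ n * (w * r * e) := by
            rw [hS]
            simpa using Finset.sum_le_card_nsmul (Finset.range n) g _ hgi
        _ = n * w * r * e := by ring
        _ ≤ s * r * r * e := by gcongr
    have h2 := mul_le_mul_of_nonneg_left h1 hη
    linarith
  have hu : ∀ i, i ≤ n → frob (seg V 1 i - seg W 1 i) ≤ q * α ^ i := by
    intro i hi
    have h1 := frob_seg_sub_le hα hη hW (G := G) (by rw [← hS, ← hq]; linarith) i hi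
    have h2 : ∑ j ∈ Finset.range i, frob (G (j + 1)) ≤ S := hS ▸
      Finset.sum_le_sum_of_subset_of_nonneg (Finset.range_mono hi) fun _ _ _ => frob_nonneg _
    calc frob (seg V 1 i - seg W 1 i) ≤ α * frob (seg V 1 i - seg W 1 i) :=
          le_mul_of_one_le_left (frob_nonneg _) hα
      _ ≤ 2 * η * α ^ i * S := h1.trans (mul_le_mul_of_nonneg_left h2 (by positivity))
      _ = q * α ^ i := by rw [hq]; ring
  obtain ⟨X, hX⟩ : ∃ X, X = α ^ n * (w * S + g n) := ⟨_, rfl⟩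
  have hX0 : 0 ≤ X := by rw [hX]; positivity
  have hsum : ∀ (c : ℝ) (C : ℕ → Matrix (Fin d) (Fin d) ℝ), 0 ≤ c →
      (∀ i, i ≤ n → frob (G (i + 1) * C i) ≤ g i * (c * α ^ i)) →
      frob (∑ i ∈ Finset.range (n + 1), seg W (i + 2) (n + 1) * G (i + 1) * C i) ≤ c * X := by
    intro c C hc hC
    refine (frob_sum_le _ _).trans ?_
    rw [Finset.sum_range_succ, seg_of_lt W (show n + 1 < n + 2 by omega), Matrix.one_mul]
    have h1 : ∀ i ∈ Finset.range n,
        frob (seg W (i + 2) (n + 1) * G (i + 1) * C i) ≤ c * (w * α ^ n) * g i := by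
      intro i hi
      have hi' := Finset.mem_range.mp hi
      rw [Matrix.mul_assoc]
      calc frob (seg W (i + 2) (n + 1) * (G (i + 1) * C i))
          ≤ spec (seg W (i + 2) (n + 1)) * (g i * (c * α ^ i)) :=
            (frob_mul_le_spec_mul _ _).trans
              (mul_le_mul_of_nonneg_left (hC i hi'.le) (spec_nonneg _))
        _ = c * (spec (seg W (i + 2) (n + 1)) * α ^ i) * g i := by ring
        _ ≤ c * (w * α ^ n) * g i :=
            mul_le_mul_of_nonneg_right (mul_le_mul_of_nonneg_left (hA i hi') hc) (hg0 i)
    have h2 := Finset.sum_le_sum h1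
    rw [← Finset.mul_sum, ← hS] at h2
    have h3 := hC n le_rfl
    rw [hX]
    linarith
  set Q := ∑ i ∈ Finset.range (n + 1), seg W (i + 2) (n + 1) * G (i + 1) * seg W 1 i with hQ
  set H := ∑ i ∈ Finset.range (n + 1),
    seg W (i + 2) (n + 1) * G (i + 1) * (seg V 1 i - seg W 1 i) with hH
  have hQX : frob Q ≤ X := by
    simpa using hsum 1 (fun i => seg W 1 i) zero_le_one fun i hi => by
      rw [one_mul]
      exact (frob_mul_le_mul_spec _ _).trans (mul_le_mul_of_nonneg_left (hB i hi) (hg0 i))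
  have hHX : frob H ≤ q * X :=
    hsum q (fun i => seg V 1 i - seg W 1 i) hq0 fun i hi =>
      (frob_mul_le _ _).trans (mul_le_mul_of_nonneg_left (hu i hi) (hg0 i))
  have hstep : seg V 1 (n + 1) - Φ = E + (-η) • (Q + H) := by
    have h1 := seg_sub_smul W G η (n + 1)
    have h2 : Q + H = ∑ i ∈ Finset.range (n + 1),
        seg W (i + 2) (n + 1) * G (i + 1) * seg V 1 i := by
      rw [hQ, hH, ← Finset.sum_add_distrib]
      exact Finset.sum_congr rfl fun i _ => by rw [← Matrix.mul_add, add_sub_cancel]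
    rw [h2, neg_smul, ← h1, hE]
    abel
  have hEQ : finner E Q = N ^ 2 := by
    rw [hQ, finner_sum_right, ← hN2]
    refine Finset.sum_congr rfl fun i _ => ?_
    rw [finner_mul_mul, ← finner_self]
    rfl
  have hXle : X ≤ 2 * r ^ 2 * N := by
    calc X ≤ r * (r * N + N) := by
          rw [hX]
          gcongr
      _ ≤ r * (r * N + r * N) := by
          gcongr
          exact le_mul_of_one_le_left hN0 hr
      _ = 2 * r ^ 2 * N := by ring
  have hSX : S * X ≤ 2 * s * r ^ 2 * N ^ 2 := by
    calc S * X ≤ s * N * (2 * r ^ 2 * N) := by gcongr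
      _ = 2 * s * r ^ 2 * N ^ 2 := by ring
  have hEH : -(N ^ 2 / 10) ≤ finner E H := by
    have h1 : frob E * frob H ≤ N ^ 2 / 10 := by
      calc frob E * frob H ≤ e * (q * X) := mul_le_mul_of_nonneg_left hHX he0
        _ = 2 * η * e * (S * X) := by rw [hq]; ring
        _ ≤ 2 * η * e * (2 * s * r ^ 2 * N ^ 2) := by gcongr
        _ = 4 * (η * e * (s * r ^ 2)) * N ^ 2 := by ring
        _ ≤ 4 * (1 / 40) * N ^ 2 := by gcongr
        _ = N ^ 2 / 10 := by ring
    exact (neg_le_neg h1).trans (neg_le_of_abs_le (abs_finner_le E H))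
  have hΔ : frobSq ((-η) • (Q + H)) ≤ η * N ^ 2 / 20 := by
    have h1 : frob ((-η) • (Q + H)) ≤ η * (21 / 20 * X) := by
      rw [frob_smul, abs_neg, abs_of_nonneg hη]
      refine mul_le_mul_of_nonneg_left ((frob_add_le _ _).trans ?_) hη
      linarith [mul_le_mul_of_nonneg_right hq1 hX0]
    calc frobSq ((-η) • (Q + H)) = frob ((-η) • (Q + H)) ^ 2 := (frob_sq _).symm
      _ ≤ (η * (21 / 20 * (2 * r ^ 2 * N))) ^ 2 := by
          refine pow_le_pow_left₀ (frob_nonneg _) (h1.trans ?_) 2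
          gcongr
      _ = (21 / 10) ^ 2 * (η * r ^ 4) * (η * N ^ 2) := by ring
      _ ≤ (21 / 10) ^ 2 * (1 / 144) * (η * N ^ 2) := by gcongr
      _ ≤ η * N ^ 2 / 20 := by linarith [mul_nonneg hη (sq_nonneg N)]
  rw [hN2, hstep, frobSq_add, finner_smul_right, finner_add_right, hEQ]
  have := mul_le_mul_of_nonneg_left hEH hη
  linarith [mul_nonneg hη (sq_nonneg N)]

end Descent

end ZAS
/-- Lemma A.6, one-step decrease: under approximate balancedness and
`0 < η ≤ min{(64L²φ³√R)⁻¹, (144L²φ⁴)⁻¹}`, the loss after one gradient step satisfies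
`R⁺ ≤ (1 - η/2) R`. -/
theorem one_step_loss_decrease
    (d L : ℕ) (hd : 1 ≤ d) (hL : 2 ≤ L)
    (Φ : Matrix (Fin d) (Fin d) ℝ) (φ : ℝ) (hφ : 0 < φ)
    (W : ℕ → Matrix (Fin d) (Fin d) ℝ) (α δ ε η : ℝ)
    (hW : ∀ l, 1 ≤ l → l ≤ L - 1 → spec (W l) ≤ α)
    (hα1 : 1 ≤ α^(2*(L-1))) (hα2 : α^(2*(L-1)) < L * φ^2)
    (hD : ∀ l, 1 ≤ l → l ≤ L - 2 → spec (Dmat W l) ≤ δ)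
    (hδ : δ ≤ (2 * (L:ℝ)^3 * φ^2)⁻¹)
    (hDL : spec (1 + Dmat W (L-1)) ≤ ε)
    (hε : ε ≤ (4 * (L:ℝ)^2)⁻¹)
    (hη0 : 0 < η)
    (hη : η ≤ min (64 * (L:ℝ)^2 * φ^3 * Real.sqrt (loss W Φ L))⁻¹
      (144 * (L:ℝ)^2 * φ^4)⁻¹) :
    loss (fun k => W k - η • grad W Φ L k) Φ L ≤ (1 - η/2) * loss W Φ L := by
  obtain ⟨n, rfl⟩ : ∃ n, L = n + 1 := ⟨L - 1, by omega⟩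
  simp only [Nat.add_sub_cancel, show n + 1 - 2 = n - 1 by omega] at hW hα1 hα2 hD hDL
  have hn : 1 ≤ n := by omega
  have hα0 : 0 ≤ α := (spec_nonneg _).trans (hW 1 le_rfl hn)
  have hα : 1 ≤ α := (one_le_pow_iff_of_nonneg hα0 (by omega)).mp hα1
  set M : ℝ := ((n + 1 : ℕ) : ℝ) with hM
  have hMn : M = n + 1 := by rw [hM]; push_cast; ring
  have hM2 : 2 ≤ M := by rw [hM]; exact_mod_cast hL
  set E := seg W 1 (n + 1) - Φ with hE
  set s := √M with hs
  have hs2 : s ^ 2 = M := Real.sq_sqrt (by linarith)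
  have hs0 : 0 < s := Real.sqrt_pos.mpr (by linarith)
  have hr2 : (s * φ) ^ 2 = M * φ ^ 2 := by rw [mul_pow, hs2]
  have hy1 : 1 ≤ M * φ ^ 2 := hα1.trans hα2.le
  have hεM : M * (4 * M ^ 2)⁻¹ ≤ 1 / 8 := by
    rw [← div_eq_mul_inv, div_le_iff₀ (by positivity)]
    linarith [mul_le_mul_of_nonneg_left hM2 (zero_le_two.trans hM2)]
  have hδM : M * (M * (2 * M ^ 3 * φ ^ 2)⁻¹) ≤ 1 / 2 := by
    rw [← mul_assoc, ← div_eq_mul_inv, div_le_iff₀ (by positivity)]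
    linarith [mul_le_mul_of_nonneg_left hy1 (sq_nonneg M)]
  have hεpos : 0 < (4 * M ^ 2)⁻¹ := by positivity
  have hδpos : 0 < (2 * M ^ 3 * φ ^ 2)⁻¹ := by positivity
  have hε8 : (4 * M ^ 2)⁻¹ ≤ 1 / 8 := by
    linarith [mul_le_mul_of_nonneg_right hM2 hεpos.le]
  set ε' := (4 * M ^ 2)⁻¹ with hε'
  set δ' := (2 * M ^ 3 * φ ^ 2)⁻¹ with hδ'
  have hn0 : (1 : ℝ) ≤ n := by exact_mod_cast hn
  have hnM : (n : ℝ) ≤ M := by linarith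
  have hτ : n * (ε' + n * δ') ≤ 5 / 8 := by
    have h1 : n * (ε' + n * δ') ≤ M * (ε' + M * δ') := by
      gcongr
    linarith
  have hτ1 : ε' + n * δ' ≤ 5 / 8 :=
    (le_mul_of_one_le_left (by positivity) hn0).trans hτ
  have hsig : ∀ l, 1 ≤ l → l ≤ n → SqBoundedBelow (W l) (1 - ε' - n * δ') := fun l h1 h2 =>
    sqBoundedBelow_of_balanced hδpos.le (by linarith) (fun l h1 h2 => (hD l h1 h2).trans hδ)
      (hDL.trans hε) l h1 h2
  have hseg : SqBoundedBelow (seg W 1 n) (3 / 8) := by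
    refine (sqBoundedBelow_seg (by linarith) hsig n le_rfl).mono ?_
    have h1 := one_add_mul_le_pow (a := -(ε' + n * δ')) (by linarith) n
    rw [show 1 - ε' - n * δ' = 1 + -(ε' + n * δ') by ring]
    linarith
  have hgrad : 3 / 8 * frobSq E ≤ frobSq (grad W Φ (n + 1) (n + 1)) := by
    have h1 := hseg.le_frobSq_mul_transpose E
    rwa [grad, seg_of_lt W (show n + 1 < n + 1 + 1 by omega), Matrix.transpose_one,
      Matrix.one_mul]
  have hw : n * spec (W (n + 1)) ^ 2 ≤ (s * φ) ^ 2 := by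
    have h1 := spec_sq_le_of_spec_one_add_Dmat_le hα (hW n hn le_rfl) (hDL.trans hε)
    have h2 := one_add_mul_le_pow (a := α ^ 2 - 1) (by linarith [sq_nonneg α]) n
    rw [add_sub_cancel, ← pow_mul] at h2
    have h3 := mul_le_mul_of_nonneg_left h1 (zero_le_one.trans hn0)
    rw [hr2]
    linarith [mul_le_mul_of_nonneg_right hnM hεpos.le]
  have hη1 := hη.trans (min_le_left _ _)
  have hη2 := hη.trans (min_le_right _ _)
  have hR : loss W Φ (n + 1) = frobSq E / 2 := rfl
  have hstep := frobSq_step_le (Φ := Φ) (s := s) (r := s * φ) hα hη0.le hW hs0.le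
    (by linarith) (abs_le_of_sq_le_sq' (by
      rw [hr2, ← pow_mul, mul_comm n]
      exact hα2.le) (by positivity) |>.2) hw
    (by
      have h1 : frob E ≤ 3 / 2 * √(loss W Φ (n + 1)) := by
        refine abs_le_of_sq_le_sq' ?_ (by positivity) |>.2
        rw [mul_pow, Real.sq_sqrt (by rw [hR]; linarith [frobSq_nonneg E]), hR, frob_sq]
        linarith [frobSq_nonneg E]
      have h2 : 0 < 64 * M ^ 2 * φ ^ 3 * √(loss W Φ (n + 1)) :=
        inv_pos.mp (hη0.trans_le hη1)
      rw [← one_div, le_div_iff₀ h2] at hη1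
      rw [show s * (s * φ) ^ 3 = (s ^ 2) ^ 2 * φ ^ 3 by ring, hs2]
      calc η * frob E * (M ^ 2 * φ ^ 3)
          ≤ η * (3 / 2 * √(loss W Φ (n + 1))) * (M ^ 2 * φ ^ 3) := by gcongr
        _ ≤ 1 / 40 := by linarith)
    (by
      rw [← one_div, le_div_iff₀ (by positivity)] at hη2
      rw [show (s * φ) ^ 4 = (s ^ 2) ^ 2 * φ ^ 4 by ring, hs2]
      linarith)
  have hsum : frobSq (grad W Φ (n + 1) (n + 1)) ≤
      ∑ i ∈ Finset.range (n + 1), frobSq (grad W Φ (n + 1) (i + 1)) :=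
    Finset.single_le_sum (f := fun i => frobSq (grad W Φ (n + 1) (i + 1)))
      (fun i _ => frobSq_nonneg _) (Finset.self_mem_range_succ n)
  rw [← hE] at hstep
  have h1 := mul_le_mul_of_nonneg_left (hgrad.trans hsum) hη0.le
  rw [hR, loss]
  linarith [mul_nonneg hη0.le (frobSq_nonneg E)]
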